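/- Let g : S^1 → ℝ be continuous (Hölder continuous of exponent μ ∈ (0,1]) on the unit circle. Then the Schwarz integral Φ(z) = (1/(2πi)) ∮_{|τ|=1} g(τ)·(τ+z)/(τ-z)·dτ/τ defines a holomorphic function on the open unit disk whose real part extends continuously to the boundary with boundary values Re Φ(τ) = g(τ) for |τ| = 1. -/

import Mathlib

open Metric Complex

lemma schwarz_aux_mono (u v : ℂ → ℝ) (hu : ContinuousOn u (sphere 0 1))
    (hv : ContinuousOn v (sphere 0 1)) (h : ∀ ζ ∈ sphere (0:ℂ) 1, u ζ ≤ v ζ)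
    (z : ℂ) (hz : z ∈ ball (0:ℂ) 1) :
    Real.circleAverage ((re ∘ herglotzRieszKernel 0 z) • u) 0 1
      ≤ Real.circleAverage ((re ∘ herglotzRieszKernel 0 z) • v) 0 1 := by
  have hk : ContinuousOn (re ∘ herglotzRieszKernel 0 z) (sphere 0 1) := by
    have := continuousOn_herglotzRieszKernel_sphere hz
    rw [abs_one] at this
    exact Complex.continuous_re.comp_continuousOn this
  refine Real.circleAverage_mono ((hk.smul hu).circleIntegrable zero_le_one)
    ((hk.smul hv).circleIntegrable zero_le_one) ?_
  intro ζ hζ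
  rw [abs_one] at hζ
  have h1 := le_re_herglotzRieszKernel hζ hz
  have h2 : 0 ≤ (re ∘ herglotzRieszKernel 0 z) ζ := by
    refine le_trans ?_ h1
    have : ‖z‖ < 1 := by simpa using hz
    simp only [sub_zero]
    exact div_nonneg (by linarith) (by positivity)
  exact mul_le_mul_of_nonneg_left (h ζ hζ) h2

lemma schwarz_aux_affine (a b : ℂ) (z : ℂ) (hz : z ∈ ball (0:ℂ) 1) :
    Real.circleAverage ((re ∘ herglotzRieszKernel 0 z) • (fun ζ => (a + b * ζ).re)) 0 1
      = (a + b * z).re := by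
  have hd : DiffContOnCl ℂ (fun ζ : ℂ => a + b * ζ) (ball 0 1) :=
    Differentiable.diffContOnCl (by fun_prop)
  have h1 := hd.circleAverage_re_herglotzRieszKernel_smul hz
  have hk : ContinuousOn (re ∘ herglotzRieszKernel 0 z) (sphere 0 1) := by
    have := continuousOn_herglotzRieszKernel_sphere hz
    rw [abs_one] at this
    exact Complex.continuous_re.comp_continuousOn this
  have hi : CircleIntegrable ((re ∘ herglotzRieszKernel 0 z) • (fun ζ : ℂ => a + b * ζ)) 0 1 :=
    ContinuousOn.circleIntegrable zero_le_one
      (hk.smul (by fun_prop : Continuous (fun ζ : ℂ => a + b * ζ)).continuousOn)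
  have h2 := Complex.reCLM.circleAverage_comp_comm hi
  rw [h1] at h2
  rw [← Complex.reCLM_apply, ← h2]
  congr 1
  ext ζ
  simp
  ring

/-- For `g` Hölder continuous of exponent `μ ∈ (0,1]` on the unit circle, the
Schwarz integral `Φ(z) = (1/(2πi)) ∮_{|τ|=1} g(τ)(τ+z)/(τ-z) dτ/τ` is
holomorphic on the open unit disk and its real part extends continuously to
the closed disk with boundary values `g`. -/
theorem schwarz_integral_solves_schwarz_problem (g : ℂ → ℝ) (μ C : ℝ)
    (hμ : 0 < μ) (hμ1 : μ ≤ 1) (hC : 0 ≤ C)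
    (hg : ∀ τ ∈ sphere (0 : ℂ) 1, ∀ τ' ∈ sphere (0 : ℂ) 1,
      |g τ - g τ'| ≤ C * ‖τ - τ'‖ ^ μ) :
    let Φ : ℂ → ℂ := fun z =>
      (1 / (2 * Real.pi * Complex.I)) *
        ∮ τ in C(0, 1), (g τ : ℂ) * (τ + z) / (τ - z) / τ
    DifferentiableOn ℂ Φ (ball (0 : ℂ) 1) ∧
      ∃ F : ℂ → ℝ, ContinuousOn F (closedBall (0 : ℂ) 1) ∧
        (∀ z ∈ ball (0 : ℂ) 1, F z = (Φ z).re) ∧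
        ∀ τ ∈ sphere (0 : ℂ) 1, F τ = g τ := by
  intro Φ
  classical
  have hgc : ContinuousOn g (sphere 0 1) := by
    intro τ hτ
    have hlim : Filter.Tendsto (fun ζ : ℂ => C * ‖ζ - τ‖ ^ μ) (nhdsWithin τ (sphere 0 1))
        (nhds 0) := by
      have : Continuous (fun ζ : ℂ => C * ‖ζ - τ‖ ^ μ) := by
        refine continuous_const.mul (Continuous.rpow_const (by fun_prop) ?_)
        intro _; right; exact hμ.le
      have h := (this.tendsto τ).mono_left (nhdsWithin_le_nhds (s := sphere (0:ℂ) 1))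
      simpa [Real.zero_rpow hμ.ne'] using h
    refine tendsto_iff_dist_tendsto_zero.2 (squeeze_zero' ?_ ?_ hlim)
    · exact Filter.Eventually.of_forall fun _ => dist_nonneg
    · filter_upwards [self_mem_nhdsWithin] with ζ hζ
      exact hg ζ hζ τ hτ
  have hgi : CircleIntegrable g 0 1 := hgc.circleIntegrable zero_le_one
  have hgi' : CircleIntegrable (fun ζ => (g ζ : ℂ)) 0 1 :=
    (Complex.continuous_ofReal.comp_continuousOn hgc).circleIntegrable zero_le_one
  have hΦ : Φ = fun w ↦ Real.circleAverage
      (fun ζ ↦ herglotzRieszKernel 0 w ζ • (g ζ : ℂ)) 0 1 := by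
    funext w
    rw [Real.circleAverage_eq_circleIntegral one_ne_zero]
    simp only [Φ, one_div, smul_eq_mul, herglotzRieszKernel_def, sub_zero]
    congr 2
    funext ζ
    ring
  have hdiff : DifferentiableOn ℂ Φ (ball (0 : ℂ) 1) := by
    rw [hΦ]
    exact differentiableOn_circleAverage_herglotzRieszKernel_smul hgi'
  have hre : ∀ z ∈ ball (0:ℂ) 1, (Φ z).re =
      Real.circleAverage ((re ∘ herglotzRieszKernel 0 z) • g) 0 1 := by
    intro z hz
    rw [hΦ]
    exact re_circleAverage_herglotzRieszKernel_smul hgi hz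
  refine ⟨hdiff, fun z => if z ∈ ball (0:ℂ) 1 then (Φ z).re else g z, ?_, ?_, ?_⟩
  · intro τ hτ
    by_cases hb : τ ∈ ball (0:ℂ) 1
    · have h1 : ContinuousAt (fun z => (Φ z).re) τ :=
        Complex.continuous_re.continuousAt.comp
          (hdiff.continuousOn.continuousAt (isOpen_ball.mem_nhds hb))
      refine (h1.congr ?_).continuousWithinAt
      filter_upwards [isOpen_ball.mem_nhds hb] with z hz
      rw [if_pos hz]
    · have hτs : τ ∈ sphere (0:ℂ) 1 := by
        simp only [mem_closedBall, mem_ball, mem_sphere, not_lt] at *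
        exact le_antisymm hτ hb
      have hτn : ‖τ‖ = 1 := by simpa using hτs
      rw [Metric.continuousWithinAt_iff']
      intro ε hε
      simp only [if_neg hb]
      obtain ⟨η, hη, hηg⟩ := Metric.continuousOn_iff.1 hgc τ hτs (ε / 2) (half_pos hε)
      set K : ℝ := C * 2 ^ μ / η ^ 2 with hK
      have hK0 : 0 ≤ K := by positivity
      -- the affine majorant
      set b : ℂ := -(2 * K) * (starRingEnd ℂ) τ with hbdef
      have hval : ∀ ζ ∈ sphere (0:ℂ) 1, ∀ a : ℝ,
          (((a + 2 * K : ℝ) : ℂ) + b * ζ).re = a + K * ‖ζ - τ‖ ^ 2 := by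
        intro ζ hζ a
        have hζn : ‖ζ‖ = 1 := by simpa using hζ
        have e1 : ζ.re * ζ.re + ζ.im * ζ.im = 1 := by
          rw [← Complex.normSq_apply, Complex.normSq_eq_norm_sq, hζn]; norm_num
        have e2 : τ.re * τ.re + τ.im * τ.im = 1 := by
          rw [← Complex.normSq_apply, Complex.normSq_eq_norm_sq, hτn]; norm_num
        rw [← Complex.normSq_eq_norm_sq, Complex.normSq_apply]
        simp [hbdef]
        linear_combination (-K) * e1 - K * e2
      have hbound : ∀ ζ ∈ sphere (0:ℂ) 1, |g ζ - g τ| ≤ ε / 2 + K * ‖ζ - τ‖ ^ 2 := by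
        intro ζ hζ
        have hζn : ‖ζ‖ = 1 := by simpa using hζ
        by_cases hd : dist ζ τ < η
        · have := hηg ζ hζ hd
          rw [Real.dist_eq] at this
          have : 0 ≤ K * ‖ζ - τ‖ ^ 2 := by positivity
          linarith
        · rw [dist_eq_norm, not_lt] at hd
          have h2 : ‖ζ - τ‖ ≤ 2 := by
            have := norm_sub_le ζ τ
            linarith
          have h3 : C * ‖ζ - τ‖ ^ μ ≤ C * 2 ^ μ := by gcongr
          have h4 : C * 2 ^ μ ≤ K * ‖ζ - τ‖ ^ 2 := by
            calc C * 2 ^ μ = K * η ^ 2 := by rw [hK]; field_simp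
              _ ≤ _ := by gcongr
          linarith [hg ζ hζ τ hτs]
      have hev : ∀ᶠ z in nhdsWithin τ (closedBall (0:ℂ) 1),
          (((ε / 2 + 2 * K : ℝ) : ℂ) + b * z).re < ε := by
        have hc : Continuous (fun z : ℂ => (((ε / 2 + 2 * K : ℝ) : ℂ) + b * z).re) := by fun_prop
        have h0 := hval τ hτs (ε / 2)
        have := hc.continuousAt (x := τ) |>.eventually_lt_const (u := ε) (by
          beta_reduce; rw [h0, sub_self, norm_zero]; linarith)
        exact nhdsWithin_le_nhds this
      have hcs : ∀ᶠ z in nhdsWithin τ (closedBall (0:ℂ) 1), dist z τ < η :=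
        nhdsWithin_le_nhds (Metric.ball_mem_nhds τ hη)
      filter_upwards [hev, hcs, self_mem_nhdsWithin] with z hz1 hz2 hz3
      by_cases hzb : z ∈ ball (0:ℂ) 1
      · rw [if_pos hzb, hre z hzb, Real.dist_eq, abs_lt]
        have hcont : ∀ a b : ℂ, ContinuousOn (fun ζ : ℂ => (a + b * ζ).re) (sphere 0 1) :=
          fun a b => Continuous.continuousOn (by fun_prop)
        have up := schwarz_aux_mono g (fun ζ => (((g τ + ε / 2 + 2 * K : ℝ) : ℂ) + b * ζ).re)
          hgc (hcont _ _) (fun ζ hζ => by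
            rw [hval ζ hζ]; linarith [(abs_le.1 (hbound ζ hζ)).2]) z hzb
        have lo := schwarz_aux_mono
          (fun ζ => (((g τ - ε / 2 - 2 * K : ℝ) : ℂ) + (-b) * ζ).re) g
          (hcont _ _) hgc (fun ζ hζ => by
            have h1 := hval ζ hζ (-(g τ) + ε / 2)
            have h2 := (abs_le.1 (hbound ζ hζ)).1
            simp only [add_re, ofReal_re, neg_mul, neg_re] at h1 ⊢
            linarith) z hzb
        rw [schwarz_aux_affine _ _ z hzb] at up lo
        simp only [add_re, ofReal_re, neg_mul, neg_re] at up lo hz1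
        constructor <;> linarith
      · rw [if_neg hzb]
        have hzs : z ∈ sphere (0:ℂ) 1 := by
          simp only [mem_closedBall, mem_ball, mem_sphere, not_lt] at *
          exact le_antisymm hz3 hzb
        exact (hηg z hzs hz2).trans (half_lt_self hε)
  · intro z hz
    exact if_pos hz
  · intro τ hτ
    refine if_neg ?_
    simp only [mem_ball, mem_sphere] at *
    rw [hτ]; exact lt_irrefl _
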